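/- Maximal entanglement is faithful: for every bipartite density matrix ρ_AB on ℂ^{d_A} ⊗ ℂ^{d_B}, μ_ent(ρ_AB) = 0 if and only if ρ_AB is separable, i.e., ρ_AB = Σ_i p_i σ_A^{(i)} ⊗ σ_B^{(i)} for some finite probability distribution (p_i) and density matrices σ_A^{(i)}, σ_B^{(i)}. -/

import Mathlib

open scoped Matrix Kronecker ComplexOrder
open Matrix

noncomputable section

/-- Partial trace over the second (B) system. -/
def ptrB {A B : Type*} [Fintype B] (ρ : Matrix (A × B) (A × B) ℂ) : Matrix A A ℂ :=
  fun i j => ∑ k, ρ (i, k) (j, k)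

/-- Partial trace over the first (A) system. -/
def ptrA {A B : Type*} [Fintype A] (ρ : Matrix (A × B) (A × B) ℂ) : Matrix B B ℂ :=
  fun k l => ∑ i, ρ (i, k) (i, l)

/-- A density matrix: positive semidefinite with trace one. -/
def IsDensity {n : Type*} [Fintype n] (ρ : Matrix n n ℂ) : Prop :=
  ρ.PosSemidef ∧ ρ.trace = 1

/-- Maximal correlation of a bipartite state. -/
def mu {A B : Type*} [Fintype A] [Fintype B] (ρ : Matrix (A × B) (A × B) ℂ) : ℝ :=
  sSup {r : ℝ | ∃ (X : Matrix A A ℂ) (Y : Matrix B B ℂ),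
    ((ptrB ρ) * X).trace = 0 ∧ ((ptrA ρ) * Y).trace = 0 ∧
    ((ptrB ρ) * (X * Xᴴ)).trace = 1 ∧ ((ptrA ρ) * (Y * Yᴴ)).trace = 1 ∧
    r = ‖(ρ * (X ⊗ₖ Yᴴ)).trace‖}

/-- Maximal entanglement: infimum over finite decompositions of the max correlation. -/
def muEnt {A B : Type*} [Fintype A] [Fintype B] (ρ : Matrix (A × B) (A × B) ℂ) : ℝ :=
  sInf {r : ℝ | ∃ (m : ℕ) (p : Fin m → ℝ) (τ : Fin m → Matrix (A × B) (A × B) ℂ),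
    (∀ i, 0 ≤ p i) ∧ (∑ i, p i) = 1 ∧ (∀ i, IsDensity (τ i)) ∧
    ρ = ∑ i, p i • τ i ∧ r = ⨆ i, mu (τ i)}

/-- Application of a product channel given by local Kraus operators. -/
def applyLocal {A B A' B' ι κ : Type*} [Fintype A] [Fintype B] [Fintype ι] [Fintype κ]
    (K : ι → Matrix A' A ℂ) (L : κ → Matrix B' B ℂ)
    (ρ : Matrix (A × B) (A × B) ℂ) : Matrix (A' × B') (A' × B') ℂ :=
  ∑ k, ∑ m, (K k ⊗ₖ L m) * ρ * (K k ⊗ₖ L m)ᴴ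

/-- Tensor product of two bipartite states, with the A-systems grouped together. -/
def prodState {A B A' B' : Type*}
    (ρ : Matrix (A × B) (A × B) ℂ) (σ : Matrix (A' × B') (A' × B') ℂ) :
    Matrix ((A × A') × (B × B')) ((A × A') × (B × B')) ℂ :=
  fun x y => ρ (x.1.1, x.2.1) (y.1.1, y.2.1) * σ (x.1.2, x.2.2) (y.1.2, y.2.2)

/-- n-fold tensor power of a bipartite state, with all A-systems grouped together. -/
def powState {A B : Type*} (ρ : Matrix (A × B) (A × B) ℂ) (n : ℕ) :
    Matrix ((Fin n → A) × (Fin n → B)) ((Fin n → A) × (Fin n → B)) ℂ :=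
  fun x y => ∏ i, ρ (x.1 i, x.2 i) (y.1 i, y.2 i)

/-- The two-qubit Bell vector (|00⟩+|11⟩)/√2. -/
def bellVec : Fin 2 × Fin 2 → ℂ := fun p => if p.1 = p.2 then 1 / (Real.sqrt 2 : ℂ) else 0

/-- Inverse of the positive semidefinite square root. -/
def invSqrt {n : Type*} [Fintype n] [DecidableEq n] (M : Matrix n n ℂ) : Matrix n n ℂ :=
  letI := Classical.dec M.PosSemidef
  if h : M.PosSemidef then
    ((h.1.eigenvectorUnitary : Matrix n n ℂ) *
      diagonal (((↑) : ℝ → ℂ) ∘ Real.sqrt ∘ h.1.eigenvalues) *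
      (star h.1.eigenvectorUnitary : Matrix n n ℂ))⁻¹ else 0


/-- Separability of a bipartite density matrix. -/
def Separable {dA dB : ℕ} (ρ : Matrix (Fin dA × Fin dB) (Fin dA × Fin dB) ℂ) : Prop :=
  ∃ (m : ℕ) (p : Fin m → ℝ) (σA : Fin m → Matrix (Fin dA) (Fin dA) ℂ)
    (σB : Fin m → Matrix (Fin dB) (Fin dB) ℂ),
    (∀ i, 0 ≤ p i) ∧ (∑ i, p i) = 1 ∧ (∀ i, IsDensity (σA i)) ∧ (∀ i, IsDensity (σB i)) ∧
    ρ = ∑ i, p i • (σA i ⊗ₖ σB i)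

/-- In finite dimension, the convex hull of a compact set is compact. -/
theorem IsCompact.convexHull_of_finiteDimensional {E : Type*} [AddCommGroup E] [Module ℝ E]
    [FiniteDimensional ℝ E] [TopologicalSpace E] [IsTopologicalAddGroup E] [ContinuousSMul ℝ E]
    {s : Set E} (hs : IsCompact s) : IsCompact (convexHull ℝ s) := by
  have h : convexHull ℝ s = ⋃ k ∈ Finset.range (Module.finrank ℝ E + 2),
      Set.image (fun q : (Fin k → ℝ) × (Fin k → E) => ∑ i, q.1 i • q.2 i)
        (stdSimplex ℝ (Fin k) ×ˢ Set.univ.pi fun _ => s) := by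
    ext x
    simp only [Set.mem_iUnion, Finset.mem_range, exists_prop]
    constructor
    · intro hx
      obtain ⟨ι, _, z, w, hz, hind, hw, hw1, rfl⟩ := eq_pos_convex_span_of_mem_convexHull hx
      let e := Fintype.equivFin ι
      have hcard := hind.card_le_finrank_succ.trans
        (Nat.succ_le_succ (Submodule.finrank_le (vectorSpan ℝ (Set.range z))))
      refine ⟨Fintype.card ι, by omega, (w ∘ e.symm, z ∘ e.symm),
        ⟨⟨fun i => (hw _).le, ?_⟩, fun i _ => hz ⟨_, rfl⟩⟩, ?_⟩
      · exact (e.symm.sum_comp w).trans hw1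
      · exact e.symm.sum_comp fun i => w i • z i
    · rintro ⟨k, -, q, ⟨⟨hw, hw1⟩, hz⟩, rfl⟩
      exact mem_convexHull_of_exists_fintype q.1 q.2 hw hw1 (fun i => hz i trivial) rfl
  rw [h]
  refine (Finset.range _).isCompact_biUnion fun k _ => IsCompact.image ?_ (by fun_prop)
  exact (isCompact_stdSimplex ℝ (Fin k)).prod (isCompact_univ_pi fun _ => hs)

lemma ptrB_kronecker {A B : Type*} [Fintype B] (σ : Matrix A A ℂ) {τ : Matrix B B ℂ}
    (h : τ.trace = 1) : ptrB (σ ⊗ₖ τ) = σ := by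
  ext i j
  simpa [ptrB, ← Finset.mul_sum, Matrix.trace] using congrArg (σ i j * ·) h

section PartialTrace

variable {A B : Type*} [Fintype A] [Fintype B]

lemma trace_mul_kronecker_one [DecidableEq B] (ρ : Matrix (A × B) (A × B) ℂ) (X : Matrix A A ℂ) :
    (ρ * (X ⊗ₖ (1 : Matrix B B ℂ))).trace = (ptrB ρ * X).trace := by
  simp only [Matrix.trace, Matrix.diag, Matrix.mul_apply, Fintype.sum_prod_type, kroneckerMap_apply,
    Matrix.one_apply, ptrB, mul_ite, mul_one, mul_zero, Finset.sum_ite_eq', Finset.mem_univ, if_true,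
    Finset.sum_mul]
  exact Finset.sum_congr rfl fun i _ => Finset.sum_comm

lemma trace_mul_one_kronecker [DecidableEq A] (ρ : Matrix (A × B) (A × B) ℂ) (Y : Matrix B B ℂ) :
    (ρ * ((1 : Matrix A A ℂ) ⊗ₖ Y)).trace = (ptrA ρ * Y).trace := by
  simp only [Matrix.trace, Matrix.diag, Matrix.mul_apply, Fintype.sum_prod_type, kroneckerMap_apply,
    Matrix.one_apply, ptrA, ite_mul, mul_ite, one_mul, zero_mul, mul_zero, Finset.sum_mul]
  rw [Finset.sum_comm]
  refine Finset.sum_congr rfl fun i _ => ?_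
  rw [Finset.sum_comm]
  conv_rhs => rw [Finset.sum_comm]
  simp [Finset.sum_comm (γ := A)]

lemma IsDensity.ptrB {ρ : Matrix (A × B) (A × B) ℂ} (h : IsDensity ρ) : IsDensity (ptrB ρ) := by
  classical
  constructor
  · have : _root_.ptrB ρ = ∑ k, ρ.submatrix (fun i => (i, k)) (fun i => (i, k)) := by
      ext i j
      simp [_root_.ptrB, Matrix.sum_apply]
    rw [this]
    exact posSemidef_sum _ fun k _ => h.1.submatrix _
  · simpa [h.2] using (trace_mul_kronecker_one ρ 1).symm

lemma IsDensity.ptrA {ρ : Matrix (A × B) (A × B) ℂ} (h : IsDensity ρ) : IsDensity (ptrA ρ) := by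
  classical
  constructor
  · have : _root_.ptrA ρ = ∑ k, ρ.submatrix (fun i => (k, i)) (fun i => (k, i)) := by
      ext i j
      simp [_root_.ptrA, Matrix.sum_apply]
    rw [this]
    exact posSemidef_sum _ fun k _ => h.1.submatrix _
  · simpa [h.2] using (trace_mul_one_kronecker ρ 1).symm

lemma IsDensity.kronecker {σ : Matrix A A ℂ} {τ : Matrix B B ℂ} (hσ : IsDensity σ)
    (hτ : IsDensity τ) : IsDensity (σ ⊗ₖ τ) :=
  ⟨hσ.1.kronecker hτ.1, by rw [trace_kronecker, hσ.2, hτ.2, one_mul]⟩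

end PartialTrace

section Variance

variable {n : Type*} [Fintype n]

lemma Matrix.PosSemidef.trace_mul_self_conjTranspose_nonneg {M : Matrix n n ℂ} (hM : M.PosSemidef)
    (P : Matrix n n ℂ) : 0 ≤ (M * (P * Pᴴ)).trace := by
  have h := (hM.conjTranspose_mul_mul_same P).trace_nonneg
  rwa [trace_mul_cycle, Matrix.mul_assoc, trace_mul_comm, Matrix.mul_assoc, trace_mul_comm,
    Matrix.mul_assoc] at h

lemma Matrix.PosSemidef.ofReal_re_trace_mul {M : Matrix n n ℂ} (hM : M.PosSemidef)
    (P : Matrix n n ℂ) : ((M * (P * Pᴴ)).trace.re : ℂ) = (M * (P * Pᴴ)).trace :=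
  (Complex.eq_re_of_ofReal_le (r := 0)
    (by simpa using hM.trace_mul_self_conjTranspose_nonneg P)).symm

/-- Cauchy–Schwarz for the sesquilinear form induced by a positive semidefinite matrix. -/
lemma Matrix.PosSemidef.norm_trace_mul_le {M : Matrix n n ℂ} (hM : M.PosSemidef)
    (P Q : Matrix n n ℂ) :
    ‖(M * (P * Qᴴ)).trace‖ ≤
      √(M * (P * Pᴴ)).trace.re * √(M * (Q * Qᴴ)).trace.re := by
  let := M.toMatrixSeminormedAddCommGroup hM
  let := M.toMatrixInnerProductSpace hM
  have key (P Q : Matrix n n ℂ) : inner ℂ Pᴴ Qᴴ = (M * (P * Qᴴ)).trace := by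
    change (Qᴴ * M * Pᴴᴴ).trace = _
    rw [conjTranspose_conjTranspose, trace_mul_cycle, Matrix.mul_assoc, trace_mul_comm,
      Matrix.mul_assoc, trace_mul_comm, Matrix.mul_assoc]
  have h := norm_inner_le_norm (𝕜 := ℂ) Pᴴ Qᴴ
  rw [norm_eq_sqrt_re_inner (𝕜 := ℂ) Pᴴ, norm_eq_sqrt_re_inner (𝕜 := ℂ) Qᴴ, key, key, key] at h
  exact h

lemma Matrix.IsHermitian.trace_mul_conjTranspose {M : Matrix n n ℂ} (hM : M.IsHermitian)
    (X : Matrix n n ℂ) : (M * Xᴴ).trace = star (M * X).trace := by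
  rw [← trace_conjTranspose, conjTranspose_mul, hM.eq, trace_mul_comm]

/-- Centering an observable does not increase its second moment. -/
lemma IsDensity.re_trace_mul_centered_le [DecidableEq n] {M : Matrix n n ℂ} (hM : IsDensity M)
    (X : Matrix n n ℂ) :
    (M * ((X - (M * X).trace • 1) * (X - (M * X).trace • 1)ᴴ)).trace.re ≤
      (M * (X * Xᴴ)).trace.re := by
  have h : (M * ((X - (M * X).trace • 1) * (X - (M * X).trace • 1)ᴴ)).trace =
      (M * (X * Xᴴ)).trace - (M * X).trace * star (M * X).trace := by
    simp only [conjTranspose_sub, conjTranspose_smul, conjTranspose_one, Matrix.mul_sub,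
      Matrix.sub_mul, Matrix.mul_smul, Matrix.smul_mul, Matrix.mul_one, Matrix.one_mul, trace_sub,
      trace_smul, hM.1.1.trace_mul_conjTranspose, hM.2, smul_eq_mul]
    ring
  rw [h, Complex.sub_re, Complex.star_def, Complex.mul_conj, Complex.ofReal_re]
  linarith [Complex.normSq_nonneg (M * X).trace]

lemma IsDensity.re_apply_self_le_one {M : Matrix n n ℂ} (hM : IsDensity M) (i : n) :
    (M i i).re ≤ 1 := by
  have h : ∑ j, (M j j).re = 1 := by
    simpa [Matrix.trace] using congrArg Complex.re hM.2
  rw [← h]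
  exact Finset.single_le_sum (f := fun j => (M j j).re)
    (fun j _ => (Complex.le_def.1 (hM.1.diag_nonneg (i := j))).1) (Finset.mem_univ i)

lemma IsDensity.re_trace_mul_single_le_one [DecidableEq n] {M : Matrix n n ℂ} (hM : IsDensity M)
    (i j : n) : (M * (single i j (1 : ℂ) * (single i j (1 : ℂ))ᴴ)).trace.re ≤ 1 := by
  simpa [conjTranspose_single, trace_mul_single] using hM.re_apply_self_le_one i

lemma IsDensity.norm_apply_le_one {M : Matrix n n ℂ} (hM : IsDensity M) (i j : n) :
    ‖M i j‖ ≤ 1 := by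
  classical
  have h := hM.1.norm_trace_mul_le (single j j 1) (single i j 1)
  have h' : (M * (single j j 1 * (single i j 1)ᴴ)).trace = M i j := by
    simp [conjTranspose_single, trace_mul_single]
  rw [h'] at h
  exact h.trans (mul_le_one₀ (Real.sqrt_le_one.2 (hM.re_trace_mul_single_le_one j j))
    (Real.sqrt_nonneg _) (Real.sqrt_le_one.2 (hM.re_trace_mul_single_le_one i j)))

lemma isCompact_setOf_isDensity : IsCompact {M : Matrix n n ℂ | IsDensity M} := by
  have hK : IsCompact {M : Matrix n n ℂ | ∀ i j, M i j ∈ Metric.closedBall (0 : ℂ) 1} := by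
    have := isCompact_pi_infinite (ι := n) (X := fun _ => n → ℂ) fun _ =>
      isCompact_pi_infinite (ι := n) (X := fun _ => ℂ) fun _ => isCompact_closedBall (0 : ℂ) 1
    exact this
  refine hK.of_isClosed_subset ?_ fun M hM i j => by simpa using hM.norm_apply_le_one i j
  have h : {M : Matrix n n ℂ | IsDensity M} = {M | Mᴴ = M} ∩
      (⋂ x : n → ℂ, {M | 0 ≤ star x ⬝ᵥ (M *ᵥ x)}) ∩ {M | M.trace = 1} := by
    ext M
    simp [IsDensity, posSemidef_iff_dotProduct_mulVec, IsHermitian]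
  rw [h]
  refine ((isClosed_eq (by fun_prop) (by fun_prop)).inter (isClosed_iInter fun x => ?_)).inter
    (isClosed_eq (by fun_prop) (by fun_prop))
  exact isClosed_le continuous_const (by fun_prop)

end Variance

section MaximalCorrelation

variable {A B : Type*} [Fintype A] [Fintype B]

lemma mu_nonneg (ρ : Matrix (A × B) (A × B) ℂ) : 0 ≤ mu ρ := by
  refine Real.sSup_nonneg ?_
  rintro r ⟨X, Y, -, -, -, -, rfl⟩
  exact norm_nonneg _

/-- Cauchy–Schwarz for correlations of local observables. -/
lemma IsDensity.norm_trace_mul_kronecker_le {ρ : Matrix (A × B) (A × B) ℂ} (hρ : IsDensity ρ)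
    (X : Matrix A A ℂ) (Y : Matrix B B ℂ) :
    ‖(ρ * (X ⊗ₖ Yᴴ)).trace‖ ≤
      √(_root_.ptrB ρ * (X * Xᴴ)).trace.re * √(_root_.ptrA ρ * (Y * Yᴴ)).trace.re := by
  classical
  have h := hρ.1.norm_trace_mul_le (X ⊗ₖ (1 : Matrix B B ℂ)) ((1 : Matrix A A ℂ) ⊗ₖ Y)
  simpa only [conjTranspose_kronecker, conjTranspose_one, ← mul_kronecker_mul, Matrix.mul_one,
    Matrix.one_mul, trace_mul_kronecker_one, trace_mul_one_kronecker] using h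

lemma mu_kronecker {σ : Matrix A A ℂ} {τ : Matrix B B ℂ} (hτ : τ.trace = 1) :
    mu (σ ⊗ₖ τ) = 0 := by
  refine le_antisymm (Real.sSup_nonpos ?_) (mu_nonneg _)
  rintro r ⟨X, Y, hX, -, -, -, rfl⟩
  rw [ptrB_kronecker _ hτ] at hX
  rw [← mul_kronecker_mul, trace_kronecker, hX, zero_mul, norm_zero]

lemma IsDensity.norm_trace_mul_kronecker_le_mu {ρ : Matrix (A × B) (A × B) ℂ} (hρ : IsDensity ρ)
    {X : Matrix A A ℂ} {Y : Matrix B B ℂ} (hX : (_root_.ptrB ρ * X).trace = 0)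
    (hY : (_root_.ptrA ρ * Y).trace = 0) :
    ‖(ρ * (X ⊗ₖ Yᴴ)).trace‖ ≤ mu ρ *
      (√(_root_.ptrB ρ * (X * Xᴴ)).trace.re * √(_root_.ptrA ρ * (Y * Yᴴ)).trace.re) := by
  have hCS := hρ.norm_trace_mul_kronecker_le X Y
  set v := √(_root_.ptrB ρ * (X * Xᴴ)).trace.re with hv
  set w := √(_root_.ptrA ρ * (Y * Yᴴ)).trace.re with hw
  have hv0 : 0 ≤ v := Real.sqrt_nonneg _
  have hw0 : 0 ≤ w := Real.sqrt_nonneg _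
  rcases hv0.eq_or_lt with h | hvpos
  · rw [← h] at hCS ⊢
    simpa using hCS
  rcases hw0.eq_or_lt with h | hwpos
  · rw [← h] at hCS ⊢
    simpa using hCS
  have hv2 : (_root_.ptrB ρ * (X * Xᴴ)).trace = (v : ℂ) * v := by
    rw [← hρ.ptrB.1.ofReal_re_trace_mul, ← Complex.ofReal_mul, hv,
      Real.mul_self_sqrt (Real.sqrt_pos.1 hvpos).le]
  have hw2 : (_root_.ptrA ρ * (Y * Yᴴ)).trace = (w : ℂ) * w := by
    rw [← hρ.ptrA.1.ofReal_re_trace_mul, ← Complex.ofReal_mul, hw,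
      Real.mul_self_sqrt (Real.sqrt_pos.1 hwpos).le]
  have hvC : (v : ℂ) ≠ 0 := by exact_mod_cast hvpos.ne'
  have hwC : (w : ℂ) ≠ 0 := by exact_mod_cast hwpos.ne'
  have hbdd : (v * w)⁻¹ * ‖(ρ * (X ⊗ₖ Yᴴ)).trace‖ ≤ mu ρ := by
    refine le_csSup ⟨1, ?_⟩ ⟨(v : ℂ)⁻¹ • X, (w : ℂ)⁻¹ • Y, ?_, ?_, ?_, ?_, ?_⟩
    · rintro r ⟨X, Y, -, -, hX, hY, rfl⟩
      simpa [hX, hY] using hρ.norm_trace_mul_kronecker_le X Y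
    · simp [hX]
    · simp [hY]
    · simp [hv2, hvC]
    · simp [hw2, hwC]
    · simp [smul_kronecker, kronecker_smul, abs_of_pos hvpos, abs_of_pos hwpos]
      ring
  rwa [inv_mul_le_iff₀ (by positivity), mul_comm] at hbdd

/-- A state is entrywise within its maximal correlation of the product of its marginals. -/
lemma IsDensity.norm_sub_kronecker_apply_le {ρ : Matrix (A × B) (A × B) ℂ} (hρ : IsDensity ρ)
    (x y : A × B) : ‖(ρ - _root_.ptrB ρ ⊗ₖ _root_.ptrA ρ) x y‖ ≤ mu ρ := by
  classical
  set X : Matrix A A ℂ := single y.1 x.1 1 with hX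
  set Y : Matrix B B ℂ := single x.2 y.2 1 with hY
  set a := (_root_.ptrB ρ * X).trace with ha
  set b := (_root_.ptrA ρ * Y).trace with hb
  have h := hρ.norm_trace_mul_kronecker_le_mu (X := X - a • 1) (Y := Y - b • 1)
    (by simp [Matrix.mul_sub, hρ.ptrB.2, ← ha]) (by simp [Matrix.mul_sub, hρ.ptrA.2, ← hb])
  have hentry : (ρ * ((X - a • 1) ⊗ₖ (Y - b • 1)ᴴ)).trace =
      (ρ - _root_.ptrB ρ ⊗ₖ _root_.ptrA ρ) x y := by
    have h1 : (ρ * (X ⊗ₖ Yᴴ)).trace = ρ x y := by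
      simp [hX, hY, conjTranspose_single, single_kronecker_single, trace_mul_single]
    have h2 : a = _root_.ptrB ρ x.1 y.1 := by simp [ha, hX, trace_mul_single]
    have h3 : (_root_.ptrA ρ * Yᴴ).trace = _root_.ptrA ρ x.2 y.2 := by
      simp [hY, conjTranspose_single, trace_mul_single]
    have h4 : star b = _root_.ptrA ρ x.2 y.2 := by
      rw [← h3, hρ.ptrA.1.1.trace_mul_conjTranspose]
    have hexpand : (X - a • 1) ⊗ₖ (Y - b • 1)ᴴ = X ⊗ₖ Yᴴ - star b • (X ⊗ₖ (1 : Matrix B B ℂ)) -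
        a • ((1 : Matrix A A ℂ) ⊗ₖ Yᴴ) +
        (a * star b) • ((1 : Matrix A A ℂ) ⊗ₖ (1 : Matrix B B ℂ)) := by
      ext p q
      simp only [conjTranspose_sub, conjTranspose_smul, conjTranspose_one, Matrix.sub_apply,
        Matrix.add_apply, Matrix.smul_apply, kroneckerMap_apply, smul_eq_mul]
      ring
    rw [hexpand]
    simp only [Matrix.mul_add, Matrix.mul_sub, Matrix.mul_smul, trace_add, trace_sub,
      trace_smul, trace_mul_kronecker_one, trace_mul_one_kronecker, Matrix.mul_one, h1, h3, ← ha,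
      h4, hρ.ptrB.2, smul_eq_mul, Matrix.sub_apply, kroneckerMap_apply, ← h2]
    ring
  rw [hentry] at h
  refine h.trans (mul_le_of_le_one_right (mu_nonneg ρ) (mul_le_one₀ ?_ (Real.sqrt_nonneg _) ?_))
  · exact Real.sqrt_le_one.2
      ((hρ.ptrB.re_trace_mul_centered_le X).trans (hρ.ptrB.re_trace_mul_single_le_one _ _))
  · exact Real.sqrt_le_one.2
      ((hρ.ptrA.re_trace_mul_centered_le Y).trans (hρ.ptrA.re_trace_mul_single_le_one _ _))

end MaximalCorrelation

section ProductStates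

/-- The set of product states. -/
def productStates (A B : Type*) [Fintype A] [Fintype B] : Set (Matrix (A × B) (A × B) ℂ) :=
  Set.image (fun q : Matrix A A ℂ × Matrix B B ℂ => q.1 ⊗ₖ q.2)
    ({σ | IsDensity σ} ×ˢ {τ | IsDensity τ})

lemma isCompact_convexHull_productStates (A B : Type*) [Fintype A] [Fintype B] :
    IsCompact (convexHull ℝ (productStates A B)) := by
  refine IsCompact.convexHull_of_finiteDimensional
    ((isCompact_setOf_isDensity.prod isCompact_setOf_isDensity).image ?_)
  refine continuous_matrix fun x y => ?_
  simp only [kroneckerMap_apply]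
  fun_prop

lemma separable_of_mem_convexHull {dA dB : ℕ}
    {ρ : Matrix (Fin dA × Fin dB) (Fin dA × Fin dB) ℂ}
    (h : ρ ∈ convexHull ℝ (productStates (Fin dA) (Fin dB))) : Separable ρ := by
  obtain ⟨ι, _, w, z, hw, hw1, hz, hsum⟩ := mem_convexHull_iff_exists_fintype.1 h
  choose q hq hqz using hz
  let e := Fintype.equivFin ι
  refine ⟨Fintype.card ι, w ∘ e.symm, fun i => (q (e.symm i)).1, fun i => (q (e.symm i)).2,
    fun i => hw _, ?_, fun i => (hq _).1, fun i => (hq _).2, ?_⟩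
  · rw [← hw1]
    exact e.symm.sum_comp w
  · rw [← hsum, ← e.symm.sum_comp]
    exact Finset.sum_congr rfl fun i _ => by rw [← hqz]; rfl

end ProductStates

/-- Maximal entanglement is faithful: it vanishes exactly on separable states. -/
theorem muEnt_eq_zero_iff_separable {dA dB : ℕ}
    (ρ : Matrix (Fin dA × Fin dB) (Fin dA × Fin dB) ℂ) (hρ : IsDensity ρ) :
    muEnt ρ = 0 ↔ Separable ρ := by
  have hbdd : BddBelow {r : ℝ | ∃ (m : ℕ) (p : Fin m → ℝ)
      (τ : Fin m → Matrix (Fin dA × Fin dB) (Fin dA × Fin dB) ℂ),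
      (∀ i, 0 ≤ p i) ∧ (∑ i, p i) = 1 ∧ (∀ i, IsDensity (τ i)) ∧
      ρ = ∑ i, p i • τ i ∧ r = ⨆ i, mu (τ i)} := by
    refine ⟨0, ?_⟩
    rintro r ⟨m, p, τ, -, -, -, -, rfl⟩
    exact Real.iSup_nonneg fun i => mu_nonneg _
  constructor
  · intro h
    refine separable_of_mem_convexHull ?_
    rw [← (isCompact_convexHull_productStates (Fin dA) (Fin dB)).isClosed.closure_eq]
    have happrox (k : ℕ) : ∃ s ∈ convexHull ℝ (productStates (Fin dA) (Fin dB)),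
        ∀ x y, ‖s x y - ρ x y‖ ≤ 1 / ((k : ℝ) + 1) := by
      have hpos : muEnt ρ < 1 / ((k : ℝ) + 1) := by rw [h]; positivity
      obtain ⟨r, ⟨m, p, τ, hp, hp1, hτ, hdec, rfl⟩, hlt⟩ := exists_lt_of_csInf_lt
        (by exact ⟨_, 1, fun _ => 1, fun _ => ρ, by simp, by simp, fun _ => hρ, by simp, rfl⟩)
        hpos
      refine ⟨∑ i, p i • (ptrB (τ i) ⊗ₖ ptrA (τ i)), ?_, fun x y => ?_⟩
      · exact mem_convexHull_of_exists_fintype p _ hp hp1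
          (fun i => ⟨(_, _), ⟨(hτ i).ptrB, (hτ i).ptrA⟩, rfl⟩) rfl
      · have hi (i : Fin m) : ‖p i • ((τ i - ptrB (τ i) ⊗ₖ ptrA (τ i)) x y)‖ ≤
            p i * (1 / ((k : ℝ) + 1)) := by
          rw [norm_smul, Real.norm_of_nonneg (hp i)]
          exact mul_le_mul_of_nonneg_left (((hτ i).norm_sub_kronecker_apply_le x y).trans
            ((le_ciSup (f := fun i => mu (τ i)) (Set.finite_range _).bddAbove i).trans hlt.le))
            (hp i)
        have hsub : ρ x y - (∑ i, p i • (ptrB (τ i) ⊗ₖ ptrA (τ i))) x y =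
            ∑ i, p i • ((τ i - ptrB (τ i) ⊗ₖ ptrA (τ i)) x y) := by
          rw [hdec]
          simp only [Matrix.sum_apply, Matrix.smul_apply, Matrix.sub_apply, smul_sub,
            Finset.sum_sub_distrib]
        rw [norm_sub_rev, hsub]
        refine (norm_sum_le_of_le _ fun i _ => hi i).trans ?_
        rw [← Finset.sum_mul, hp1, one_mul]
    choose s hs hclose using happrox
    refine mem_closure_of_tendsto (f := s) (b := Filter.atTop) ?_ (Filter.Eventually.of_forall hs)
    refine tendsto_pi_nhds.2 fun x => tendsto_pi_nhds.2 fun y => ?_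
    exact tendsto_iff_norm_sub_tendsto_zero.2 (squeeze_zero (fun _ => norm_nonneg _)
      (fun k => hclose k x y) tendsto_one_div_add_atTop_nhds_zero_nat)
  · rintro ⟨m, p, σA, σB, hp, hp1, hA, hB, hdec⟩
    refine le_antisymm (csInf_le hbdd ⟨m, p, fun i => σA i ⊗ₖ σB i, hp, hp1,
      fun i => (hA i).kronecker (hB i), hdec, ?_⟩) (Real.sInf_nonneg ?_)
    · simp [mu_kronecker (hB _).2]
    · rintro r ⟨m, p, τ, -, -, -, -, rfl⟩
      exact Real.iSup_nonneg fun i => mu_nonneg _
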